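/- The Möbius band has a unique 5-vertex triangulation: on a 5-cycle C_5 with vertices x_1,...,x_5, the complex whose triangles are {x} \cup e_x for each vertex x of C_5, where e_x is the edge of C_5 opposite x, is a triangulation of the Möbius band, and any 5-vertex triangulation of the Möbius band is isomorphic to it. -/

import Mathlib

/-- A (finite, abstract) simplicial complex: a finite family of nonempty finite
vertex sets (faces), closed under passing to nonempty subsets. -/
def SC (K : Finset (Finset ℕ)) : Prop :=
  ∅ ∉ K ∧ ∀ s ∈ K, ∀ t : Finset ℕ, t ⊆ s → t ≠ ∅ → t ∈ K

/-- `fv K i` is the number of `i`-dimensional faces of `K` (faces with `i+1` vertices). -/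
def fv (K : Finset (Finset ℕ)) (i : ℕ) : ℕ :=
  (K.filter (fun s => s.card = i + 1)).card

/-- The link of a vertex `v` in `K`. -/
def link (K : Finset (Finset ℕ)) (v : ℕ) : Finset (Finset ℕ) :=
  K.filter (fun s => v ∉ s ∧ insert v s ∈ K)

/-- The `n`-cycle complex on the vertices `g 0, …, g (n-1)` (in this cyclic order). -/
def cycleOn (n : ℕ) (g : ℕ → ℕ) : Finset (Finset ℕ) :=
  (Finset.range n).image (fun i => ({g i} : Finset ℕ)) ∪
    (Finset.range n).image (fun i => ({g i, g ((i + 1) % n)} : Finset ℕ))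

/-- `C` is an `n`-cycle for some `n ≥ 3`. -/
def IsCycleComplex (C : Finset (Finset ℕ)) : Prop :=
  ∃ n g, 3 ≤ n ∧ Set.InjOn g (Set.Iio n) ∧ C = cycleOn n g

/-- The path complex on the vertices `g 0, …, g (n-1)` (in this order). -/
def pathOn (n : ℕ) (g : ℕ → ℕ) : Finset (Finset ℕ) :=
  (Finset.range n).image (fun i => ({g i} : Finset ℕ)) ∪
    (Finset.range (n - 1)).image (fun i => ({g i, g (i + 1)} : Finset ℕ))

/-- `C` is a path with at least one edge. -/
def IsPathComplex (C : Finset (Finset ℕ)) : Prop :=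
  ∃ n g, 2 ≤ n ∧ Set.InjOn g (Set.Iio n) ∧ C = pathOn n g

/-- Connectedness of a complex: any two vertices are joined by an edge path. -/
def Conn (K : Finset (Finset ℕ)) : Prop :=
  ∀ u v : ℕ, ({u} : Finset ℕ) ∈ K → ({v} : Finset ℕ) ∈ K →
    Relation.ReflTransGen (fun a b => ({a, b} : Finset ℕ) ∈ K) u v

/-- A triangulated closed (connected) 2-manifold: a nonempty connected 2-dimensional
simplicial complex in which the link of every vertex is a cycle. -/
def Surface2 (K : Finset (Finset ℕ)) : Prop :=
  SC K ∧ K ≠ ∅ ∧ (∀ s ∈ K, s.card ≤ 3) ∧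
    (∀ v : ℕ, ({v} : Finset ℕ) ∈ K → IsCycleComplex (link K v)) ∧ Conn K

/-- Neighbourly: any two vertices form an edge. -/
def Neighbourly (K : Finset (Finset ℕ)) : Prop :=
  ∀ u v : ℕ, ({u} : Finset ℕ) ∈ K → ({v} : Finset ℕ) ∈ K → u ≠ v →
    ({u, v} : Finset ℕ) ∈ K

/-- A triangulation of the 2-sphere: a triangulated closed connected 2-manifold
with Euler characteristic 2. -/
def TriS2 (K : Finset (Finset ℕ)) : Prop :=
  Surface2 K ∧ fv K 0 + fv K 2 = fv K 1 + 2

/-- The simplicial complex generated by a family of faces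
(all nonempty subsets of the given faces). -/
def sclosure (ts : Finset (Finset ℕ)) : Finset (Finset ℕ) :=
  ts.biUnion (fun t => t.powerset.erase ∅)

/-- `K` is isomorphic to `L` via a vertex relabelling. -/
def IsoTo (K L : Finset (Finset ℕ)) : Prop :=
  ∃ g : ℕ → ℕ, Function.Injective g ∧ K.image (Finset.image g) = L

/-- Boundary complex of the tetrahedron: all proper nonempty subsets of {0,1,2,3}. -/
def TetraB : Finset (Finset ℕ) :=
  sclosure {{0, 1, 2}, {0, 1, 3}, {0, 2, 3}, {1, 2, 3}}

/-- A triangulated compact (connected) 2-manifold with boundary: vertex links are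
cycles or paths. -/
def SurfaceWB (K : Finset (Finset ℕ)) : Prop :=
  SC K ∧ K ≠ ∅ ∧ (∀ s ∈ K, s.card ≤ 3) ∧
    (∀ v : ℕ, ({v} : Finset ℕ) ∈ K →
      IsCycleComplex (link K v) ∨ IsPathComplex (link K v)) ∧ Conn K

/-- The boundary edges: edges lying in exactly one triangle. -/
def bdEdges (K : Finset (Finset ℕ)) : Finset (Finset ℕ) :=
  K.filter (fun e => e.card = 2 ∧ (K.filter (fun t => t.card = 3 ∧ e ⊆ t)).card = 1)

/-- The boundary complex: boundary edges and their vertices. -/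
def bdComplex (K : Finset (Finset ℕ)) : Finset (Finset ℕ) :=
  bdEdges K ∪ (bdEdges K).biUnion (fun e => e.image (fun x => ({x} : Finset ℕ)))

/-- The directed edges of an ordered triangle. -/
def dtri (p : ℕ × ℕ × ℕ) : Finset (ℕ × ℕ) :=
  {(p.1, p.2.1), (p.2.1, p.2.2), (p.2.2, p.1)}

/-- Orientability: each triangle can be given a cyclic orientation so that no two
distinct triangles induce the same directed edge (adjacent triangles are
coherently oriented). -/
def Orientable (K : Finset (Finset ℕ)) : Prop :=
  ∃ o : Finset ℕ → ℕ × ℕ × ℕ,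
    (∀ t ∈ K, t.card = 3 → t = {(o t).1, (o t).2.1, (o t).2.2}) ∧
    ∀ t ∈ K, ∀ t' ∈ K, t.card = 3 → t'.card = 3 → t ≠ t' →
      ∀ x y : ℕ, (x, y) ∈ dtri (o t) → (x, y) ∉ dtri (o t')

/-- A triangulation of the Möbius band: a connected compact non-orientable surface
with boundary, with Euler characteristic 0, whose boundary is a single cycle. -/
def MoebiusBand (K : Finset (Finset ℕ)) : Prop :=
  SurfaceWB K ∧ bdEdges K ≠ ∅ ∧ IsCycleComplex (bdComplex K) ∧
    fv K 0 + fv K 2 = fv K 1 ∧ ¬ Orientable K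

/-- The 5-vertex Möbius band: on the 5-cycle 1,2,3,4,5 the triangles are
`{x} ∪ eₓ`, where `eₓ` is the edge of the cycle opposite the vertex `x`. -/
def M5 : Finset (Finset ℕ) :=
  sclosure {{1, 3, 4}, {2, 4, 5}, {3, 5, 1}, {4, 1, 2}, {5, 2, 3}}


lemma cyc_deg (n : ℕ) (g : ℕ → ℕ) (hn : 3 ≤ n) (hg : Set.InjOn g (Set.Iio n)) (y : ℕ)
    (hy : {y} ∈ cycleOn n g) :
    1 ≤ ((cycleOn n g).filter (fun s => s.card = 2 ∧ y ∈ s)).card ∧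
    ((cycleOn n g).filter (fun s => s.card = 2 ∧ y ∈ s)).card ≤ 2 := by
  have hne : ∀ i < n, g i ≠ g ((i + 1) % n) := by
    intro i hi h
    have h2 := hg (show i ∈ Set.Iio n from hi) (show (i+1) % n ∈ Set.Iio n from Nat.mod_lt _ (by omega)) h
    rcases Nat.lt_or_ge (i+1) n with h3 | h3
    · rw [Nat.mod_eq_of_lt h3] at h2; omega
    · have : i + 1 = n := by omega
      rw [this, Nat.mod_self] at h2; omega
  obtain ⟨i, hi, rfl⟩ : ∃ i < n, g i = y := by
    simp only [cycleOn, Finset.mem_union, Finset.mem_image, Finset.mem_range] at hy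
    rcases hy with ⟨i, hi, h⟩ | ⟨i, hi, h⟩
    · exact ⟨i, hi, by simpa using h⟩
    · have := congrArg Finset.card h
      rw [Finset.card_pair (hne i hi)] at this
      simp at this
  constructor
  · apply Finset.card_pos.mpr
    refine ⟨{g i, g ((i+1) % n)}, ?_⟩
    simp only [Finset.mem_filter]
    refine ⟨?_, Finset.card_pair (hne i hi), by simp⟩
    simp only [cycleOn, Finset.mem_union, Finset.mem_image, Finset.mem_range]
    exact Or.inr ⟨i, hi, rfl⟩
  · have hsub : (cycleOn n g).filter (fun s => s.card = 2 ∧ g i ∈ s) ⊆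
        {{g i, g ((i+1) % n)}, {g ((i + (n - 1)) % n), g i}} := by
      intro s hs
      simp only [cycleOn, Finset.mem_filter, Finset.mem_union, Finset.mem_image, Finset.mem_range] at hs
      obtain ⟨⟨j, hj, rfl⟩ | ⟨j, hj, rfl⟩, hc, hm⟩ := hs
      · simp at hc
      · simp only [Finset.mem_insert, Finset.mem_singleton] at hm ⊢
        rcases hm with hm | hm
        · have := hg hi hj hm
          subst this; left; rfl
        · have h2 := hg (show i ∈ Set.Iio n from hi) (show (j+1) % n ∈ Set.Iio n from Nat.mod_lt _ (by omega)) hm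
          right
          have : (i + (n-1)) % n = j := by
            rw [h2, Nat.mod_add_mod, show j + 1 + (n-1) = j + n by omega, Nat.add_mod_right,
              Nat.mod_eq_of_lt hj]
          rw [this, h2.symm]
    exact (Finset.card_le_card hsub).trans Finset.card_le_two

lemma path_deg (n : ℕ) (g : ℕ → ℕ) (hn : 2 ≤ n) (hg : Set.InjOn g (Set.Iio n)) (y : ℕ)
    (hy : {y} ∈ pathOn n g) :
    1 ≤ ((pathOn n g).filter (fun s => s.card = 2 ∧ y ∈ s)).card ∧
    ((pathOn n g).filter (fun s => s.card = 2 ∧ y ∈ s)).card ≤ 2 := by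
  have hne : ∀ i < n - 1, g i ≠ g (i + 1) := by
    intro i hi h
    have h2 := hg (show i ∈ Set.Iio n by simp; omega) (show i+1 ∈ Set.Iio n by simp; omega) h
    omega
  obtain ⟨i, hi, rfl⟩ : ∃ i < n, g i = y := by
    simp only [pathOn, Finset.mem_union, Finset.mem_image, Finset.mem_range] at hy
    rcases hy with ⟨i, hi, h⟩ | ⟨i, hi, h⟩
    · exact ⟨i, hi, by simpa using h⟩
    · have := congrArg Finset.card h
      rw [Finset.card_pair (hne i hi)] at this
      simp at this
  constructor
  · apply Finset.card_pos.mpr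
    rcases Nat.lt_or_ge i (n - 1) with h | h
    · refine ⟨{g i, g (i+1)}, ?_⟩
      simp only [Finset.mem_filter]
      refine ⟨?_, Finset.card_pair (hne i h), by simp⟩
      simp only [pathOn, Finset.mem_union, Finset.mem_image, Finset.mem_range]
      exact Or.inr ⟨i, h, rfl⟩
    · obtain ⟨j, rfl⟩ : ∃ j, i = j + 1 := ⟨i - 1, by omega⟩
      refine ⟨{g j, g (j+1)}, ?_⟩
      simp only [Finset.mem_filter]
      refine ⟨?_, Finset.card_pair (hne j (by omega)), by simp⟩
      simp only [pathOn, Finset.mem_union, Finset.mem_image, Finset.mem_range]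
      exact Or.inr ⟨j, by omega, rfl⟩
  · have hsub : (pathOn n g).filter (fun s => s.card = 2 ∧ g i ∈ s) ⊆
        {{g i, g (i+1)}, {g (i - 1), g i}} := by
      intro s hs
      simp only [pathOn, Finset.mem_filter, Finset.mem_union, Finset.mem_image, Finset.mem_range] at hs
      obtain ⟨⟨j, hj, rfl⟩ | ⟨j, hj, rfl⟩, hc, hm⟩ := hs
      · simp at hc
      · simp only [Finset.mem_insert, Finset.mem_singleton] at hm ⊢
        rcases hm with hm | hm
        · have := hg (show i ∈ Set.Iio n from hi) (show j ∈ Set.Iio n by simp; omega) hm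
          subst this; left; rfl
        · have h2 := hg (show i ∈ Set.Iio n from hi) (show j+1 ∈ Set.Iio n by simp; omega) hm
          right
          subst h2; rfl
    exact (Finset.card_le_card hsub).trans Finset.card_le_two

/-- number of triangles on a given edge -/
def tdeg (K : Finset (Finset ℕ)) (e : Finset ℕ) : ℕ :=
  (K.filter (fun t => t.card = 3 ∧ e ⊆ t)).card

lemma edge_deg (K : Finset (Finset ℕ)) (hK : SurfaceWB K) (e : Finset ℕ) (he : e ∈ K)
    (hc : e.card = 2) : 1 ≤ tdeg K e ∧ tdeg K e ≤ 2 := by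
  obtain ⟨⟨h0, hsc⟩, -, -, hl, -⟩ := hK
  obtain ⟨x, y, hxy, rfl⟩ := Finset.card_eq_two.mp hc
  have hx : {x} ∈ K := hsc _ he _ (by simp) (by simp)
  have hy : {y} ∈ K := hsc _ he _ (by simp) (by simp)
  have hyl : {y} ∈ link K x := by
    simp only [link, Finset.mem_filter]
    exact ⟨hy, by simpa using hxy, he⟩
  have key : tdeg K {x, y} = ((link K x).filter (fun s => s.card = 2 ∧ y ∈ s)).card := by
    unfold tdeg
    apply Finset.card_nbij' (fun t => t.erase x) (fun s => insert x s)
    · intro t ht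
      simp only [Finset.coe_filter, Set.mem_ofPred_eq, Finset.insert_subset_iff, Finset.singleton_subset_iff] at ht
      obtain ⟨ht, h3, hxt, hyt⟩ := ht
      have hyy : y ∈ t.erase x := Finset.mem_erase.mpr ⟨hxy.symm, hyt⟩
      simp only [Finset.coe_filter, Set.mem_ofPred_eq, link, Finset.mem_filter]
      refine ⟨⟨hsc _ ht _ (Finset.erase_subset _ _) (Finset.ne_empty_of_mem hyy), by simp, ?_⟩, ?_, hyy⟩
      · rwa [Finset.insert_erase hxt]
      · rw [Finset.card_erase_of_mem hxt, h3]
    · intro s hs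
      simp only [Finset.coe_filter, Set.mem_ofPred_eq, link, Finset.mem_filter] at hs
      obtain ⟨⟨hs, hxs, hi⟩, h2, hys⟩ := hs
      simp only [Finset.coe_filter, Set.mem_ofPred_eq]
      refine ⟨hi, by rw [Finset.card_insert_of_notMem hxs, h2], ?_⟩
      simp [Finset.insert_subset_iff, hys]
    · intro t ht
      simp only [Finset.coe_filter, Set.mem_ofPred_eq, Finset.insert_subset_iff] at ht
      exact Finset.insert_erase ht.2.2.1
    · intro s hs
      simp only [Finset.coe_filter, Set.mem_ofPred_eq, link, Finset.mem_filter] at hs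
      exact Finset.erase_insert hs.1.2.1
  rw [key]
  rcases hl x hx with ⟨n, g, hn, hg, h⟩ | ⟨n, g, hn, hg, h⟩
  · rw [h] at hyl ⊢; exact cyc_deg n g hn hg y hyl
  · rw [h] at hyl ⊢; exact path_deg n g hn hg y hyl

lemma double_count (K : Finset (Finset ℕ)) (hK : SurfaceWB K) :
    3 * fv K 2 + (bdEdges K).card = 2 * fv K 1 := by
  have h1 : ∑ t ∈ K.filter (fun s => s.card = 2 + 1),
      ((K.filter (fun s => s.card = 1 + 1)).filter (fun e => e ⊆ t)).card
      = ∑ e ∈ K.filter (fun s => s.card = 1 + 1),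
      ((K.filter (fun s => s.card = 2 + 1)).filter (fun t => e ⊆ t)).card :=
    (Finset.sum_card_bipartiteAbove_eq_sum_card_bipartiteBelow
      (fun t e : Finset ℕ => e ⊆ t))
  have h2 : ∀ t ∈ K.filter (fun s => s.card = 2 + 1),
      ((K.filter (fun s => s.card = 1 + 1)).filter (fun e => e ⊆ t)).card = 3 := by
    intro t ht
    rw [Finset.mem_filter] at ht
    have : (K.filter (fun s => s.card = 1 + 1)).filter (fun e => e ⊆ t) = t.powersetCard 2 := by
      ext e
      simp only [Finset.mem_filter, Finset.mem_powersetCard]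
      constructor
      · rintro ⟨⟨-, h⟩, h'⟩; exact ⟨h', h⟩
      · rintro ⟨h, h'⟩
        exact ⟨⟨hK.1.2 _ ht.1 _ h (by rintro rfl; simp at h'), h'⟩, h⟩
    rw [this, Finset.card_powersetCard, ht.2]; rfl
  rw [Finset.sum_congr rfl h2, Finset.sum_const, smul_eq_mul] at h1
  have h3 : ∀ e ∈ K.filter (fun s => s.card = 1 + 1),
      ((K.filter (fun s => s.card = 2 + 1)).filter (fun t => e ⊆ t)).card
      + (if tdeg K e = 1 then 1 else 0) = 2 := by
    intro e he
    rw [Finset.mem_filter] at he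
    have := edge_deg K hK e he.1 he.2
    rw [Finset.filter_filter]
    change tdeg K e + _ = 2
    split_ifs <;> omega
  have h4 := Finset.sum_congr rfl h3
  rw [Finset.sum_add_distrib, ← h1, Finset.sum_const, smul_eq_mul, ← Finset.card_filter,
    Finset.filter_filter] at h4
  unfold fv
  have h5 : bdEdges K = K.filter (fun e => e.card = 1 + 1 ∧ tdeg K e = 1) := rfl
  rw [h5]; omega

lemma opp_tri (K : Finset (Finset ℕ)) (p a b c d : ℕ)
    (hW : ∀ s ∈ K, s ⊆ {p, a, b, c, d}) (hd : [p, a, b, c, d].Nodup)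
    (h1 : tdeg K {p, a} ≤ 1) (h2 : 2 ≤ tdeg K {p, b}) (h3 : 2 ≤ tdeg K {p, c}) :
    ({p, b, c} : Finset ℕ) ∈ K := by
  by_contra hn
  simp only [List.nodup_cons, List.mem_cons, List.not_mem_nil, not_or, or_false] at hd
  have aux : ∀ y z u v : ℕ, ({p, y, z} : Finset ℕ) ∉ K → p ≠ y →
      (∀ s ∈ K, s ⊆ {p, y, z, u, v}) → 2 ≤ tdeg K {p, y} → ({p, y, u} : Finset ℕ) ∈ K := by
    intro y z u v hz hpy hW h2
    have hsub : K.filter (fun t => t.card = 3 ∧ {p, y} ⊆ t) ⊆ {{p, y, u}, {p, y, v}} := by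
      intro t ht
      rw [Finset.mem_filter] at ht
      obtain ⟨ht, h3, hs⟩ := ht
      obtain ⟨w, hw⟩ : ∃ w, t \ {p, y} = {w} := by
        rw [← Finset.card_eq_one, Finset.card_sdiff_of_subset hs, h3, Finset.card_pair hpy]
      have hwt : w ∈ t \ {p, y} := by rw [hw]; simp
      have htt : t = {p, y, w} := by
        rw [← Finset.union_sdiff_of_subset hs, hw]; ext; simp
      rw [Finset.mem_sdiff] at hwt
      have hwW := hW t ht hwt.1
      simp only [Finset.mem_insert, Finset.mem_singleton] at hwW hwt ⊢
      rcases hwW with h | h | h | h | h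
      · exact absurd (Or.inl h) hwt.2
      · exact absurd (Or.inr h) hwt.2
      · subst h; rw [htt] at ht; exact absurd ht hz
      · subst h; exact Or.inl htt
      · subst h; exact Or.inr htt
    have := Finset.eq_of_subset_of_card_le hsub (Finset.card_le_two.trans h2)
    have hm : ({p, y, u} : Finset ℕ) ∈ K.filter (fun t => t.card = 3 ∧ {p, y} ⊆ t) := by
      rw [this]; simp
    exact (Finset.mem_filter.mp hm).1
  have hb := aux b c a d hn (by tauto) (fun s hs x hx => by
    have := hW s hs hx
    simp only [Finset.mem_insert, Finset.mem_singleton] at this ⊢; tauto) h2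
  have hc := aux c b a d (by rwa [Finset.pair_comm c b]) (by tauto) (fun s hs x hx => by
    have := hW s hs hx
    simp only [Finset.mem_insert, Finset.mem_singleton] at this ⊢; tauto) h3
  have hbc : ({p, b, a} : Finset ℕ) ≠ {p, c, a} := by
    intro h
    have : b ∈ ({p, c, a} : Finset ℕ) := by rw [← h]; simp
    simp only [Finset.mem_insert, Finset.mem_singleton] at this
    grind
  have : ({{p, b, a}, {p, c, a}} : Finset (Finset ℕ)) ⊆
      K.filter (fun t => t.card = 3 ∧ {p, a} ⊆ t) := by
    intro t ht
    simp only [Finset.mem_insert, Finset.mem_singleton] at ht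
    rw [Finset.mem_filter]
    rcases ht with rfl | rfl
    · exact ⟨hb, Finset.card_eq_three.mpr ⟨p, b, a, by grind, by grind, by grind, rfl⟩,
        by intro x; simp; tauto⟩
    · exact ⟨hc, Finset.card_eq_three.mpr ⟨p, c, a, by grind, by grind, by grind, rfl⟩,
        by intro x; simp; tauto⟩
  have := Finset.card_le_card this
  rw [Finset.card_pair hbc] at this
  unfold tdeg at h1; omega

lemma tri_dir (a b c : ℕ) (hab : a ≠ b) (hac : a ≠ c) (hbc : b ≠ c) (p : ℕ × ℕ × ℕ)
    (h : ({a, b, c} : Finset ℕ) = {p.1, p.2.1, p.2.2}) :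
    ((a, b) ∈ dtri p ∧ (b, c) ∈ dtri p ∧ (c, a) ∈ dtri p) ∨
    ((b, a) ∈ dtri p ∧ (c, b) ∈ dtri p ∧ (a, c) ∈ dtri p) := by
  obtain ⟨x, y, z⟩ := p
  have ha : a ∈ ({x, y, z} : Finset ℕ) := by rw [← h]; simp
  have hb : b ∈ ({x, y, z} : Finset ℕ) := by rw [← h]; simp
  have hc : c ∈ ({x, y, z} : Finset ℕ) := by rw [← h]; simp
  clear h
  simp only [Finset.mem_insert, Finset.mem_singleton, dtri, Prod.mk.injEq] at *
  grind

lemma M5_nonor : ¬ Orientable M5 := by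
  rintro ⟨o, h1, h2⟩
  have m1 : ({1, 3, 4} : Finset ℕ) ∈ M5 := by decide +kernel
  have m2 : ({2, 4, 5} : Finset ℕ) ∈ M5 := by decide +kernel
  have m3 : ({3, 5, 1} : Finset ℕ) ∈ M5 := by decide +kernel
  have m4 : ({4, 1, 2} : Finset ℕ) ∈ M5 := by decide +kernel
  have m5 : ({5, 2, 3} : Finset ℕ) ∈ M5 := by decide +kernel
  have d1 := tri_dir _ _ _ (by norm_num) (by norm_num) (by norm_num) _ (h1 _ m1 rfl)
  have d2 := tri_dir _ _ _ (by norm_num) (by norm_num) (by norm_num) _ (h1 _ m2 rfl)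
  have d3 := tri_dir _ _ _ (by norm_num) (by norm_num) (by norm_num) _ (h1 _ m3 rfl)
  have d4 := tri_dir _ _ _ (by norm_num) (by norm_num) (by norm_num) _ (h1 _ m4 rfl)
  have d5 := tri_dir _ _ _ (by norm_num) (by norm_num) (by norm_num) _ (h1 _ m5 rfl)
  have e13 := h2 _ m1 _ m3 rfl rfl (by decide +kernel)
  have e24 := h2 _ m2 _ m4 rfl rfl (by decide +kernel)
  have e35 := h2 _ m3 _ m5 rfl rfl (by decide +kernel)
  have e41 := h2 _ m4 _ m1 rfl rfl (by decide +kernel)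
  have e52 := h2 _ m5 _ m2 rfl rfl (by decide +kernel)
  have a1 := e13 1 3
  have a2 := e13 3 1
  have a3 := e24 2 4
  have a4 := e24 4 2
  have a5 := e35 3 5
  have a6 := e35 5 3
  have a7 := e41 4 1
  have a8 := e41 1 4
  have a9 := e52 5 2
  have a10 := e52 2 5
  clear h1 h2 e13 e24 e35 e41 e52 m1 m2 m3 m4 m5
  generalize dtri (o {1, 3, 4}) = A at *
  generalize dtri (o {2, 4, 5}) = B at *
  generalize dtri (o {3, 5, 1}) = C at *
  generalize dtri (o {4, 1, 2}) = D at *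
  generalize dtri (o {5, 2, 3}) = E at *
  grind

lemma M5_sc : SC M5 := by
  constructor
  · decide +kernel
  · intro s hs t hts ht
    simp only [M5, sclosure, Finset.mem_biUnion, Finset.mem_erase, Finset.mem_powerset] at hs ⊢
    obtain ⟨u, hu, -, hsu⟩ := hs
    exact ⟨u, hu, ht, hts.trans hsu⟩

lemma M5_vert (v : ℕ) (h : ({v} : Finset ℕ) ∈ M5) : v = 1 ∨ v = 2 ∨ v = 3 ∨ v = 4 ∨ v = 5 := by
  have : ∀ s ∈ M5, s ⊆ {1, 2, 3, 4, 5} := by decide +kernel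
  simpa using this _ h

lemma inj_of_nodup (n : ℕ) (g : ℕ → ℕ) (h : ∀ i < n, ∀ j < n, g i = g j → i = j) :
    Set.InjOn g (Set.Iio n) := fun i hi j hj hh => h i hi j hj hh

lemma M5_moebius : MoebiusBand M5 := by
  refine ⟨⟨M5_sc, by decide +kernel, by decide +kernel, ?_, ?_⟩, by decide +kernel,
    ⟨5, fun i => i + 1, by norm_num, fun i _ j _ h => by simpa using h, by decide +kernel⟩,
    by decide +kernel, M5_nonor⟩
  · intro v hv
    right
    rcases M5_vert v hv with rfl | rfl | rfl | rfl | rfl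
    · exact ⟨4, fun i => [2, 4, 3, 5].getD i 0, by norm_num,
        inj_of_nodup _ _ (by decide +kernel), by decide +kernel⟩
    · exact ⟨4, fun i => [3, 5, 4, 1].getD i 0, by norm_num,
        inj_of_nodup _ _ (by decide +kernel), by decide +kernel⟩
    · exact ⟨4, fun i => [4, 1, 5, 2].getD i 0, by norm_num,
        inj_of_nodup _ _ (by decide +kernel), by decide +kernel⟩
    · exact ⟨4, fun i => [5, 2, 1, 3].getD i 0, by norm_num,
        inj_of_nodup _ _ (by decide +kernel), by decide +kernel⟩
    · exact ⟨4, fun i => [1, 3, 2, 4].getD i 0, by norm_num,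
        inj_of_nodup _ _ (by decide +kernel), by decide +kernel⟩
  · intro u v hu hv
    have : ∀ a ∈ ({1, 2, 3, 4, 5} : Finset ℕ), ∀ b ∈ ({1, 2, 3, 4, 5} : Finset ℕ),
      ({a, b} : Finset ℕ) ∈ M5 := by decide +kernel
    exact Relation.ReflTransGen.single
      (this u (by simpa using M5_vert u hu) v (by simpa using M5_vert v hv))

lemma uniq (K : Finset (Finset ℕ)) (hM : MoebiusBand K) (h5 : fv K 0 = 5) : IsoTo K M5 := by
  obtain ⟨hK, -, ⟨n, g, hn, hg, hbd⟩, hchi, -⟩ := hM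
  have hsc := hK.1.2
  have hdc := double_count K hK
  set W := K.biUnion id with hWdef
  have hW : ∀ s ∈ K, s ⊆ W := fun s hs => Finset.subset_biUnion_of_mem id hs
  have hWs : ∀ x ∈ W, {x} ∈ K := by
    intro x hx
    rw [hWdef, Finset.mem_biUnion] at hx
    obtain ⟨s, hs, hx⟩ := hx
    exact hsc s hs _ (by simpa using hx) (by simp)
  have hWc : W.card = 5 := by
    rw [← h5, fv, ← Finset.card_image_of_injective W (Finset.singleton_injective)]
    congr 1
    ext s
    simp only [Finset.mem_image, Finset.mem_filter]
    constructor
    · rintro ⟨x, hx, rfl⟩; exact ⟨hWs x hx, by simp⟩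
    · rintro ⟨hs, hc⟩
      obtain ⟨x, rfl⟩ := Finset.card_eq_one.mp hc
      exact ⟨x, hW _ hs (by simp), rfl⟩
  have hf1 : fv K 1 ≤ 10 := by
    have : K.filter (fun s => s.card = 1 + 1) ⊆ W.powersetCard 2 := by
      intro s hs
      rw [Finset.mem_filter] at hs
      exact Finset.mem_powersetCard.mpr ⟨hW _ hs.1, hs.2⟩
    have := Finset.card_le_card this
    rw [Finset.card_powersetCard, hWc] at this
    exact this
  have hbsub : bdEdges K ⊆ (Finset.range n).image (fun i => ({g i, g ((i + 1) % n)} : Finset ℕ)) := by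
    intro e he
    have h1 : e ∈ cycleOn n g := by rw [← hbd]; exact Finset.mem_union_left _ he
    rw [cycleOn, Finset.mem_union] at h1
    rcases h1 with h1 | h1
    · obtain ⟨i, -, rfl⟩ := Finset.mem_image.mp h1
      simp [bdEdges] at he
    · exact h1
  have hbn : (bdEdges K).card ≤ n :=
    (Finset.card_le_card hbsub).trans (Finset.card_image_le.trans (by simp))
  have hgW' : (Finset.range n).image g ⊆ W := by
    intro x hx
    obtain ⟨i, hi, rfl⟩ := Finset.mem_image.mp hx
    have h1 : ({g i} : Finset ℕ) ∈ bdComplex K := by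
      rw [hbd]; exact Finset.mem_union_left _ (Finset.mem_image.mpr ⟨i, hi, rfl⟩)
    rw [bdComplex, Finset.mem_union] at h1
    rcases h1 with h1 | h1
    · simp [bdEdges] at h1
    · simp only [Finset.mem_biUnion, Finset.mem_image] at h1
      obtain ⟨e, he, y, hy, hh⟩ := h1
      have : y = g i := by simpa using hh
      subst this
      exact hW e (Finset.mem_filter.mp he).1 hy
  have hgc : ((Finset.range n).image g).card = n := by
    rw [Finset.card_image_of_injOn (by simpa using hg), Finset.card_range]
  have hn5 : n = 5 := by
    have := Finset.card_le_card hgW'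
    omega
  subst hn5
  have hWg : (Finset.range 5).image g = W := Finset.eq_of_subset_of_card_le hgW' (by omega)
  have hf1' : fv K 1 = 10 := by omega
  have hf2 : fv K 2 = 5 := by omega
  have hbeq : bdEdges K = (Finset.range 5).image (fun i => ({g i, g ((i + 1) % 5)} : Finset ℕ)) :=
    Finset.eq_of_subset_of_card_le hbsub (Finset.card_image_le.trans (by simp; omega))
  have hfe : K.filter (fun s => s.card = 1 + 1) = W.powersetCard 2 := by
    apply Finset.eq_of_subset_of_card_le
    · intro s hs
      rw [Finset.mem_filter] at hs
      exact Finset.mem_powersetCard.mpr ⟨hW _ hs.1, hs.2⟩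
    · rw [Finset.card_powersetCard, hWc]; exact hf1'.ge
  have hd : ∀ i < 5, ∀ j < 5, g i = g j → i = j := fun i hi j hj h => hg hi hj h
  have hgm : ∀ i < 5, g i ∈ W := fun i hi => by
    rw [← hWg]; exact Finset.mem_image_of_mem g (Finset.mem_range.mpr hi)
  have hbdy : ∀ i < 5, tdeg K {g i, g ((i+1) % 5)} ≤ 1 := by
    intro i hi
    have : ({g i, g ((i + 1) % 5)} : Finset ℕ) ∈ bdEdges K := by
      rw [hbeq]; exact Finset.mem_image.mpr ⟨i, Finset.mem_range.mpr hi, rfl⟩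
    exact (Finset.mem_filter.mp this).2.2.le
  have hinner : ∀ i < 5, ∀ j < 5, i ≠ j → j ≠ (i + 1) % 5 → i ≠ (j + 1) % 5 →
      2 ≤ tdeg K {g i, g j} := by
    intro i hi j hj hij h1 h2
    have hc : ({g i, g j} : Finset ℕ).card = 2 :=
      Finset.card_pair (fun h => hij (hd i hi j hj h))
    have hm : ({g i, g j} : Finset ℕ) ∈ K := by
      have : ({g i, g j} : Finset ℕ) ∈ K.filter (fun s => s.card = 1 + 1) := by
        rw [hfe, Finset.mem_powersetCard]
        refine ⟨?_, hc⟩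
        intro x hx
        simp only [Finset.mem_insert, Finset.mem_singleton] at hx
        rcases hx with rfl | rfl
        · exact hgm i hi
        · exact hgm j hj
      exact (Finset.mem_filter.mp this).1
    have h3 := edge_deg K hK _ hm hc
    by_contra hlt
    have h4 : ({g i, g j} : Finset ℕ) ∈ bdEdges K :=
      Finset.mem_filter.mpr ⟨hm, hc, (by omega : tdeg K {g i, g j} = 1)⟩
    rw [hbeq] at h4
    obtain ⟨k, hk, hke⟩ := Finset.mem_image.mp h4
    rw [Finset.mem_range] at hk
    have hi' : g i ∈ ({g k, g ((k+1) % 5)} : Finset ℕ) := by rw [hke]; simp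
    have hj' : g j ∈ ({g k, g ((k+1) % 5)} : Finset ℕ) := by rw [hke]; simp
    simp only [Finset.mem_insert, Finset.mem_singleton] at hi' hj'
    have hk' : (k + 1) % 5 < 5 := Nat.mod_lt _ (by norm_num)
    rcases hi' with hi' | hi' <;> rcases hj' with hj' | hj' <;>
      have p := hd _ hi _ (by assumption) hi' <;>
      have q := hd _ hj _ (by assumption) hj' <;> omega
  have htri : ∀ i < 5, ({g i, g ((i+2) % 5), g ((i+3) % 5)} : Finset ℕ) ∈ K := by
    intro i hi
    apply opp_tri K (g i) (g ((i+1) % 5)) _ _ (g ((i+4) % 5))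
    · intro s hs x hx
      have := hW s hs hx
      rw [← hWg, Finset.mem_image] at this
      obtain ⟨k, hk, rfl⟩ := this
      rw [Finset.mem_range] at hk
      simp only [Finset.mem_insert, Finset.mem_singleton]
      have : k = i ∨ k = (i+1) % 5 ∨ k = (i+2) % 5 ∨ k = (i+3) % 5 ∨ k = (i+4) % 5 := by omega
      rcases this with h | h | h | h | h <;> simp [← h]
    · have hl : ([i, (i+1) % 5, (i+2) % 5, (i+3) % 5, (i+4) % 5].map g).Nodup := by
        apply List.Nodup.map_on
        · intro x hx y hy h
          simp only [List.mem_cons, List.not_mem_nil, or_false] at hx hy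
          exact hd x (by omega) y (by omega) h
        · simp; omega
      exact hl
    · exact hbdy i hi
    · exact hinner i hi _ (by omega) (by omega) (by omega) (by omega)
    · exact hinner i hi _ (by omega) (by omega) (by omega) (by omega)
  have n01 : g 0 ≠ g 1 := fun h => by have := hd 0 (by norm_num) 1 (by norm_num) h; omega
  have n02 : g 0 ≠ g 2 := fun h => by have := hd 0 (by norm_num) 2 (by norm_num) h; omega
  have n03 : g 0 ≠ g 3 := fun h => by have := hd 0 (by norm_num) 3 (by norm_num) h; omega
  have n04 : g 0 ≠ g 4 := fun h => by have := hd 0 (by norm_num) 4 (by norm_num) h; omega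
  have n12 : g 1 ≠ g 2 := fun h => by have := hd 1 (by norm_num) 2 (by norm_num) h; omega
  have n13 : g 1 ≠ g 3 := fun h => by have := hd 1 (by norm_num) 3 (by norm_num) h; omega
  have n14 : g 1 ≠ g 4 := fun h => by have := hd 1 (by norm_num) 4 (by norm_num) h; omega
  have n23 : g 2 ≠ g 3 := fun h => by have := hd 2 (by norm_num) 3 (by norm_num) h; omega
  have n24 : g 2 ≠ g 4 := fun h => by have := hd 2 (by norm_num) 4 (by norm_num) h; omega
  have n34 : g 3 ≠ g 4 := fun h => by have := hd 3 (by norm_num) 4 (by norm_num) h; omega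
  let r : ℕ → ℕ := fun x => if x = g 0 then 1 else if x = g 1 then 2 else if x = g 2 then 3
    else if x = g 3 then 4 else if x = g 4 then 5 else x + 6
  have r0 : r (g 0) = 1 := by simp [r]
  have r1 : r (g 1) = 2 := by simp [r, n01.symm]
  have r2 : r (g 2) = 3 := by simp [r, n02.symm, n12.symm]
  have r3 : r (g 3) = 4 := by simp [r, n03.symm, n13.symm, n23.symm]
  have r4 : r (g 4) = 5 := by simp [r, n04.symm, n14.symm, n24.symm, n34.symm]
  refine ⟨r, ?_, ?_⟩
  · intro x y h
    simp only [r] at h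
    split_ifs at h <;> omega
  · symm
    have hKc : K.card = 20 := by
      have h := Finset.card_eq_sum_card_fiberwise (f := Finset.card) (s := K)
        (t := {1, 2, 3}) (by
          intro s hs
          have h1 := hK.2.2.1 s hs
          have h2 : s.card ≠ 0 := by
            rw [Finset.card_ne_zero, Finset.nonempty_iff_ne_empty]
            rintro rfl; exact hK.1.1 hs
          simp; omega)
      simp only [fv] at h5 hf1' hf2
      simp at h
      norm_num at h5 hf1' hf2
      omega
    apply Finset.eq_of_subset_of_card_le
    · intro s hs
      have key : ∀ t ∈ K, s ⊆ t.image r → s ≠ ∅ → s ∈ K.image (Finset.image r) := by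
        intro t ht hst hne
        obtain ⟨u, hu, rfl⟩ := Finset.subset_image_iff.mp hst
        exact Finset.mem_image_of_mem _ (hsc t ht u (by exact_mod_cast hu) (by
          rintro rfl; simp at hne))
      simp only [M5, sclosure, Finset.mem_biUnion, Finset.mem_erase, Finset.mem_powerset] at hs
      obtain ⟨u, hu, hne, hsu⟩ := hs
      have t0 := htri 0 (by norm_num)
      have t1 := htri 1 (by norm_num)
      have t2 := htri 2 (by norm_num)
      have t3 := htri 3 (by norm_num)
      have t4 := htri 4 (by norm_num)
      norm_num at t0 t1 t2 t3 t4
      simp only [Finset.mem_insert, Finset.mem_singleton] at hu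
      rcases hu with rfl | rfl | rfl | rfl | rfl
      · exact key _ t0 (by simpa [Finset.image_insert, r0, r1, r2, r3, r4] using hsu) hne
      · exact key _ t1 (by simpa [Finset.image_insert, r0, r1, r2, r3, r4] using hsu) hne
      · exact key _ t2 (by simpa [Finset.image_insert, r0, r1, r2, r3, r4] using hsu) hne
      · exact key _ t3 (by simpa [Finset.image_insert, r0, r1, r2, r3, r4] using hsu) hne
      · exact key _ t4 (by simpa [Finset.image_insert, r0, r1, r2, r3, r4] using hsu) hne
    · refine Finset.card_image_le.trans ?_
      rw [hKc]
      have : M5.card = 20 := by decide +kernel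
      exact this.ge

/-- the Möbius band has a unique 5-vertex triangulation: the complex `M5`
(triangles `{x} ∪ eₓ` over the 5-cycle) triangulates the Möbius band, and every
5-vertex triangulation of the Möbius band is isomorphic to it. -/
theorem moebius_unique :
    (MoebiusBand M5 ∧ fv M5 0 = 5) ∧
    ∀ K : Finset (Finset ℕ), MoebiusBand K → fv K 0 = 5 → IsoTo K M5 := by
  exact ⟨⟨M5_moebius, by decide +kernel⟩, uniq⟩
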